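/- arXiv:2110.14296 — 2 statements merged into one kernel-verified Lean document; each statement's English description precedes it below -/
import Mathlib

section
/- Let n ∈ ℕ, r > 0, L_f > 0, q > 1, let f : C_r → ℝⁿ be Fréchet differentiable and L_f-Lipschitz with f(0) = 0, and let V : ℝⁿ → ℝ be convex and differentiable with c₁·‖y‖₂² ≤ V(y) ≤ c₂·‖y‖₂² for all y ∈ ℝⁿ, where c₁, c₂ > 0. Let K_V ∈ ℕ with K_V ≥ 1, τ_V > 0, set r_V = K_V·τ_V and assume r_V ≥ r. Let t₀ ∈ ℝ and let x be continuous on [t₀ - r_V - 2r, t₀] with x'(u) = f(x_u) for all u ∈ [t₀ - r_V - r, t₀]. Set M = 4c₂ - c₁, ρ = sup_{s ∈ [-r_V, 0]} ‖x(t₀+s)‖₂, and let w ≥ 1 satisfy sup_{s ∈ [-r_V - 2r, 0]} ‖x(t₀+s)‖₂ ≤ w·ρ. If the discretized Razumikhin condition V(x(t₀ - k·τ_V)) ≤ q·V(x(t₀)) holds for all k ∈ {0, 1, …, K_V}, then for every s ∈ [-r_V, 0]: V(x(t₀+s)) ≤ q·V(x(t₀)) + M·L_f²·w·ρ²·τ_V²/8.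 -/
open Set

/-- A convex function between `c₁‖·‖²` and `c₂‖·‖²` is Lipschitz with constant
`(4c₂ - c₁)‖a‖` in the one-sided sense at `a`. -/
lemma ConvexOn.sub_le_of_quadratic_bounds {E : Type*} [NormedAddCommGroup E] [NormedSpace ℝ E]
    {V : E → ℝ} {c₁ c₂ : ℝ} (hc₁ : 0 ≤ c₁) (hc₂ : 0 ≤ c₂) (hV : ConvexOn ℝ univ V)
    (hb : ∀ y, c₁ * ‖y‖ ^ 2 ≤ V y ∧ V y ≤ c₂ * ‖y‖ ^ 2) (a b : E) :
    V a - V b ≤ (4 * c₂ - c₁) * ‖a‖ * ‖a - b‖ := by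
  rcases eq_or_ne a 0 with rfl | ha
  · have h0 := (hb 0).2
    have h1 := (hb b).1
    have h2 : 0 ≤ c₁ * ‖b‖ ^ 2 := by positivity
    simp only [norm_zero] at h0 ⊢
    linarith
  rcases eq_or_ne a b with rfl | hab
  · simp
  have hA : 0 < ‖a‖ := norm_pos_iff.2 ha
  have hD : 0 < ‖a - b‖ := norm_pos_iff.2 (sub_ne_zero.2 hab)
  set A := ‖a‖
  set D := ‖a - b‖
  set y : E := a + (A / D) • (a - b) with hy
  have hynorm : ‖y‖ ≤ 2 * A := by
    calc ‖y‖ ≤ ‖a‖ + ‖(A / D) • (a - b)‖ := norm_add_le _ _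
      _ = A + A / D * D := by
        rw [norm_smul, Real.norm_of_nonneg (by positivity)]
      _ = 2 * A := by field_simp; ring
  have hcomb : (A / (A + D)) • b + (D / (A + D)) • y = a := by
    rw [hy]
    match_scalars <;> field_simp <;> ring
  have hconv := hV.2 (mem_univ b) (mem_univ y) (by positivity : 0 ≤ A / (A + D))
    (by positivity : 0 ≤ D / (A + D)) (by field_simp)
  rw [hcomb, smul_eq_mul, smul_eq_mul] at hconv
  have hmul : (A + D) * V a ≤ A * V b + D * V y := by
    have h := mul_le_mul_of_nonneg_left hconv (by positivity : 0 ≤ A + D)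
    have e : (A + D) * (A / (A + D) * V b + D / (A + D) * V y) = A * V b + D * V y := by
      field_simp
    linarith
  have hVy : V y ≤ 4 * c₂ * A ^ 2 := by
    have h : c₂ * ‖y‖ ^ 2 ≤ c₂ * (2 * A) ^ 2 := by gcongr
    linarith [(hb y).2]
  have hVa := (hb a).1
  refine le_of_mul_le_mul_left (a := A) ?_ hA
  have h := mul_le_mul_of_nonneg_left (sub_le_sub hVy hVa) hD.le
  nlinarith

/-- Error of linear interpolation on `[a, b]` for a curve whose derivative is `L`-Lipschitz. -/
lemma norm_sub_lineMap_le_of_lipschitz_deriv {E : Type*} [NormedAddCommGroup E]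
    [InnerProductSpace ℝ E] {x x' : ℝ → E} {a b L θ : ℝ} (hab : a ≤ b) (hL : 0 ≤ L)
    (hx : ∀ u ∈ Icc a b, HasDerivWithinAt x (x' u) (Icc a b) u)
    (hx' : ∀ u ∈ Icc a b, ∀ v ∈ Icc a b, u ≤ v → ‖x' v - x' u‖ ≤ L * (v - u))
    (hθ₀ : 0 ≤ θ) (hθ₁ : θ ≤ 1) :
    ‖x ((1 - θ) * a + θ * b) - ((1 - θ) • x a + θ • x b)‖ ≤ L * (b - a) ^ 2 / 8 := by
  set t := (1 - θ) * a + θ * b with ht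
  set e := x t - ((1 - θ) • x a + θ • x b) with he
  let g : ℝ → ℝ := fun u => inner ℝ e (x u) + ‖e‖ * L / 2 * u ^ 2
  have hg : ∀ u ∈ Ioo a b, HasDerivAt g (inner ℝ e (x' u) + ‖e‖ * L * u) u := by
    intro u hu
    have h1 := (hx u (Ioo_subset_Icc_self hu)).hasDerivAt (Icc_mem_nhds hu.1 hu.2)
    have h2 := (hasDerivAt_const u e).inner ℝ h1
    have h3 := ((hasDerivAt_id u).pow 2).const_mul (‖e‖ * L / 2)
    refine (h2.add h3).congr_deriv ?_
    simp only [inner_zero_left, id]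
    push_cast
    ring
  have hconv : ConvexOn ℝ (Icc a b) g := by
    refine MonotoneOn.convexOn_of_deriv (convex_Icc a b) ?_ ?_ ?_
    · have hxc : ContinuousOn x (Icc a b) := fun u hu => (hx u hu).continuousWithinAt
      exact (continuousOn_const.inner hxc).add (by fun_prop)
    · rw [interior_Icc]
      exact fun u hu => (hg u hu).differentiableAt.differentiableWithinAt
    · rw [interior_Icc]
      intro u hu v hv huv
      rw [(hg u hu).deriv, (hg v hv).deriv]
      have h1 : -inner ℝ e (x' v - x' u) ≤ ‖e‖ * (L * (v - u)) :=
        (neg_le_abs _).trans <| (abs_real_inner_le_norm _ _).trans <|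
          mul_le_mul_of_nonneg_left
            (hx' u (Ioo_subset_Icc_self hu) v (Ioo_subset_Icc_self hv) huv) (norm_nonneg _)
      rw [inner_sub_right] at h1
      linarith
  have h := hconv.2 (left_mem_Icc.2 hab) (right_mem_Icc.2 hab) (sub_nonneg.2 hθ₁) hθ₀ (by ring)
  simp only [smul_eq_mul, g, ← ht] at h
  have hself : ‖e‖ ^ 2 = inner ℝ e (x t) - ((1 - θ) * inner ℝ e (x a) + θ * inner ℝ e (x b)) := by
    rw [← real_inner_self_eq_norm_sq]
    nth_rewrite 2 [he]
    rw [inner_sub_right, inner_add_right, real_inner_smul_right, real_inner_smul_right]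
  have hsq : ‖e‖ * ‖e‖ ≤ ‖e‖ * (L / 2 * (θ * (1 - θ) * (b - a) ^ 2)) := by
    have : (1 - θ) * a ^ 2 + θ * b ^ 2 - t ^ 2 = θ * (1 - θ) * (b - a) ^ 2 := by rw [ht]; ring
    rw [← this]
    linarith
  have hle : L / 2 * (θ * (1 - θ) * (b - a) ^ 2) ≤ L * (b - a) ^ 2 / 8 := by
    have h1 : θ * (1 - θ) ≤ 1 / 4 := by nlinarith [sq_nonneg (2 * θ - 1)]
    have h2 : 0 ≤ L * (b - a) ^ 2 := by positivity
    nlinarith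
  rcases (norm_nonneg e).eq_or_lt with h0 | h0
  · rw [← h0]; positivity
  · exact (le_of_mul_le_mul_left hsq h0).trans hle

lemma exists_nat_mul_le_and_le_succ_mul {τ y : ℝ} {K : ℕ} (hK : 1 ≤ K) (hy₀ : 0 ≤ y)
    (hy : y ≤ K * τ) : ∃ k < K, k * τ ≤ y ∧ y ≤ (k + 1 : ℕ) * τ := by
  induction K, hK using Nat.le_induction with
  | base => exact ⟨0, one_pos, by simpa using hy₀, by simpa using hy⟩
  | succ m hm ih =>
    rcases le_total y (m * τ) with h | h
    · obtain ⟨k, hk, hk'⟩ := ih h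
      exact ⟨k, hk.trans m.lt_succ_self, hk'⟩
    · exact ⟨m, m.lt_succ_self, h, hy⟩

/-- Additive-error form of the discretized Razumikhin proposition: if the discretized
Razumikhin condition holds on the grid `{t₀ - k·τ_V}`, then along the whole interval
`[-r_V, 0]` one has `V(x(t₀+s)) ≤ q·V(x(t₀)) + M·L_f²·w·ρ²·τ_V²/8`. -/
theorem discretized_razumikhin_additive_error
    {n : ℕ} {r Lf q c₁ c₂ τV w : ℝ} {KV : ℕ}
    (hr : 0 < r) (hLf : 0 < Lf) (hq : 1 < q) (hc₁ : 0 < c₁) (hc₂ : 0 < c₂)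
    (hKV : 1 ≤ KV) (hτV : 0 < τV) (hrV : r ≤ KV * τV)
    (f : C(Icc (-r) (0:ℝ), EuclideanSpace ℝ (Fin n)) → EuclideanSpace ℝ (Fin n))
    (hfdiff : Differentiable ℝ f)
    (hflip : LipschitzWith (Real.toNNReal Lf) f) (hf0 : f 0 = 0)
    (V : EuclideanSpace ℝ (Fin n) → ℝ)
    (hVconv : ConvexOn ℝ univ V) (hVdiff : Differentiable ℝ V)
    (hsandwich : ∀ y : EuclideanSpace ℝ (Fin n),
      c₁ * ‖y‖ ^ 2 ≤ V y ∧ V y ≤ c₂ * ‖y‖ ^ 2)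
    (t₀ : ℝ) (x : ℝ → EuclideanSpace ℝ (Fin n))
    (hxc : ContinuousOn x (Icc (t₀ - KV * τV - 2 * r) t₀))
    (hsol : ∀ u : ℝ, t₀ - KV * τV - r ≤ u → u ≤ t₀ →
      ∀ xu : C(Icc (-r) (0:ℝ), EuclideanSpace ℝ (Fin n)),
        (∀ s : Icc (-r) (0:ℝ), xu s = x (u + s.1)) →
        HasDerivWithinAt x (f xu) (Icc (t₀ - KV * τV - 2 * r) t₀) u)
    (hw : 1 ≤ w)
    (hwρ : (⨆ s : Icc (-(KV * τV) - 2 * r) (0:ℝ), ‖x (t₀ + s.1)‖) ≤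
      w * ⨆ s : Icc (-(KV * τV)) (0:ℝ), ‖x (t₀ + s.1)‖)
    (hdisc : ∀ k : ℕ, k ≤ KV → V (x (t₀ - k * τV)) ≤ q * V (x t₀)) :
    ∀ s ∈ Icc (-(KV * τV)) (0:ℝ),
      V (x (t₀ + s)) ≤ q * V (x t₀) +
        (4 * c₂ - c₁) * Lf ^ 2 * w *
          (⨆ s' : Icc (-(KV * τV)) (0:ℝ), ‖x (t₀ + s'.1)‖) ^ 2 * τV ^ 2 / 8 := by
  set R : ℝ := KV * τV with hR
  have hRpos : 0 < R := hr.trans_le hrV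
  set ρ : ℝ := ⨆ s' : Icc (-R) (0:ℝ), ‖x (t₀ + s'.1)‖ with hρ
  have hbdd : ∀ a : ℝ, -R - 2 * r ≤ a →
      BddAbove (range fun s : Icc a (0:ℝ) => ‖x (t₀ + s.1)‖) := by
    intro a ha
    refine (isCompact_range (Continuous.norm (hxc.comp_continuous (by fun_prop) ?_))).bddAbove
    intro s
    constructor <;> linarith [s.2.1, s.2.2]
  have hxρ : ∀ u, t₀ - R ≤ u → u ≤ t₀ → ‖x u‖ ≤ ρ := by
    intro u h1 h2
    have := le_ciSup (hbdd (-R) (by linarith))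
      (⟨u - t₀, by linarith, by linarith⟩ : Icc (-R) (0:ℝ))
    simpa using this
  have hxwρ : ∀ u, t₀ - R - 2 * r ≤ u → u ≤ t₀ → ‖x u‖ ≤ w * ρ := by
    intro u h1 h2
    have := le_ciSup (hbdd (-R - 2 * r) le_rfl)
      (⟨u - t₀, by linarith, by linarith⟩ : Icc (-R - 2 * r) (0:ℝ))
    refine le_trans ?_ hwρ
    simpa using this
  have hρ0 : 0 ≤ ρ := (norm_nonneg _).trans (hxρ t₀ (by linarith) le_rfl)
  have hwρ0 : 0 ≤ w * ρ := by positivity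
  have hI : t₀ - R - 2 * r ≤ t₀ := by linarith
  let hist : ℝ → C(Icc (-r) (0:ℝ), EuclideanSpace ℝ (Fin n)) := fun u =>
    ⟨fun s => IccExtend hI (Set.domRestrict _ x) (u + s.1),
      (hxc.domRestrict.Icc_extend' (h := hI)).comp (by fun_prop)⟩
  have hist_apply : ∀ u, t₀ - R - r ≤ u → u ≤ t₀ → ∀ s : Icc (-r) (0:ℝ),
      hist u s = x (u + s.1) := by
    intro u h1 h2 s
    have hs : u + s.1 ∈ Icc (t₀ - R - 2 * r) t₀ := by
      constructor <;> linarith [s.2.1, s.2.2]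
    exact IccExtend_of_mem hI (Set.domRestrict _ x) hs
  have hderiv : ∀ u, t₀ - R - r ≤ u → u ≤ t₀ →
      HasDerivWithinAt x (f (hist u)) (Icc (t₀ - R - 2 * r) t₀) u := fun u h1 h2 =>
    hsol u h1 h2 _ (hist_apply u h1 h2)
  have hfsub : ∀ φ ψ, ‖f φ - f ψ‖ ≤ Lf * ‖φ - ψ‖ := by
    intro φ ψ
    have := hflip.norm_sub_le φ ψ
    rwa [Real.coe_toNNReal _ hLf.le] at this
  have hspeed : ∀ u ∈ Icc (t₀ - R - r) t₀, ‖f (hist u)‖ ≤ Lf * (w * ρ) := by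
    intro u hu
    have h := hfsub (hist u) 0
    rw [hf0, sub_zero, sub_zero] at h
    refine h.trans (mul_le_mul_of_nonneg_left ?_ hLf.le)
    refine (ContinuousMap.norm_le _ hwρ0).2 fun s => ?_
    rw [hist_apply u hu.1 hu.2]
    exact hxwρ _ (by linarith [hu.1, s.2.1]) (by linarith [hu.2, s.2.2])
  have hxlip : ∀ u ∈ Icc (t₀ - R - r) t₀, ∀ v ∈ Icc (t₀ - R - r) t₀,
      ‖x v - x u‖ ≤ Lf * (w * ρ) * ‖v - u‖ := fun u hu v hv =>
    (convex_Icc _ _).norm_image_sub_le_of_norm_hasDerivWithin_le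
      (fun z hz => (hderiv z hz.1 hz.2).mono (Icc_subset_Icc_left (by linarith))) hspeed hu hv
  have hderivlip : ∀ u ∈ Icc (t₀ - R) t₀, ∀ v ∈ Icc (t₀ - R) t₀, u ≤ v →
      ‖f (hist v) - f (hist u)‖ ≤ Lf ^ 2 * w * ρ * (v - u) := by
    intro u hu v hv huv
    have hvu : 0 ≤ v - u := sub_nonneg.2 huv
    have h : ‖hist v - hist u‖ ≤ Lf * (w * ρ) * (v - u) := by
      refine (ContinuousMap.norm_le _ (by positivity)).2 fun s => ?_
      rw [ContinuousMap.sub_apply, hist_apply u (by linarith [hu.1]) hu.2,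
        hist_apply v (by linarith [hv.1]) hv.2]
      have := hxlip (u + s.1) ⟨by linarith [hu.1, s.2.1], by linarith [hu.2, s.2.2]⟩
        (v + s.1) ⟨by linarith [hv.1, s.2.1], by linarith [hv.2, s.2.2]⟩
      rwa [add_sub_add_right_eq_sub, Real.norm_of_nonneg hvu] at this
    calc ‖f (hist v) - f (hist u)‖ ≤ Lf * ‖hist v - hist u‖ := hfsub _ _
      _ ≤ Lf * (Lf * (w * ρ) * (v - u)) := by gcongr
      _ = Lf ^ 2 * w * ρ * (v - u) := by ring
  intro s hs
  obtain ⟨k, hk, hk1, hk2⟩ := exists_nat_mul_le_and_le_succ_mul hKV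
    (neg_nonneg.2 hs.2) (neg_le.1 hs.1)
  have hkR : ((k + 1 : ℕ) : ℝ) * τV ≤ R :=
    mul_le_mul_of_nonneg_right (by exact_mod_cast hk) hτV.le
  have hk0 : 0 ≤ (k : ℝ) * τV := by positivity
  set a := t₀ - (k + 1 : ℕ) * τV with ha
  set b := t₀ - k * τV with hb
  have hba : b - a = τV := by rw [ha, hb]; push_cast; ring
  have hsub : Icc a b ⊆ Icc (t₀ - R) t₀ := Icc_subset_Icc (by linarith) (by linarith)
  set θ := (t₀ + s - a) / τV with hθ
  have hθ0 : 0 ≤ θ := div_nonneg (by linarith) hτV.le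
  have hθ1 : θ ≤ 1 := (div_le_one hτV).2 (by linarith)
  have hts : (1 - θ) * a + θ * b = t₀ + s := by
    have h : θ * τV = t₀ + s - a := div_mul_cancel₀ _ hτV.ne'
    rw [← hba] at h
    linarith
  have hinterp := norm_sub_lineMap_le_of_lipschitz_deriv (x := x) (x' := fun u => f (hist u))
    (a := a) (b := b) (L := Lf ^ 2 * w * ρ) (θ := θ) (by linarith) (by positivity)
    (fun u hu => (hderiv u (by linarith [(hsub hu).1]) (hsub hu).2).mono
      (hsub.trans (Icc_subset_Icc_left (by linarith))))
    (fun u hu v hv => hderivlip u (hsub hu) v (hsub hv)) hθ0 hθ1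
  rw [hts, hba] at hinterp
  have hVl : V ((1 - θ) • x a + θ • x b) ≤ q * V (x t₀) := by
    have h := hVconv.2 (mem_univ (x a)) (mem_univ (x b)) (sub_nonneg.2 hθ1) hθ0 (by ring)
    have h1 := mul_le_mul_of_nonneg_left (hdisc (k + 1) hk) (sub_nonneg.2 hθ1)
    have h2 := mul_le_mul_of_nonneg_left (hdisc k hk.le) hθ0
    simp only [smul_eq_mul] at h
    linarith
  have hLip := hVconv.sub_le_of_quadratic_bounds hc₁.le hc₂.le hsandwich (x (t₀ + s))
    ((1 - θ) • x a + θ • x b)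
  have hxs : ‖x (t₀ + s)‖ ≤ ρ := hxρ _ (by linarith [hs.1]) (by linarith [hs.2])
  rcases subsingleton_or_nontrivial (EuclideanSpace ℝ (Fin n)) with hn | hn
  · have hρ' : ρ = 0 := by
      simp [hρ, Subsingleton.elim (x _) 0]
    have h0 : x (t₀ + s) = 0 := Subsingleton.elim _ _
    rw [h0, norm_zero, mul_zero, zero_mul] at hLip
    rw [h0, hρ']
    linarith
  · obtain ⟨y, hy⟩ := exists_ne (0 : EuclideanSpace ℝ (Fin n))
    have hy2 : 0 < ‖y‖ ^ 2 := by positivity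
    have hc : c₁ ≤ c₂ :=
      le_of_mul_le_mul_right ((hsandwich y).1.trans (hsandwich y).2) hy2
    have hM : 0 ≤ 4 * c₂ - c₁ := by linarith
    have hbound : (4 * c₂ - c₁) * ‖x (t₀ + s)‖ * ‖x (t₀ + s) - ((1 - θ) • x a + θ • x b)‖ ≤
        (4 * c₂ - c₁) * ρ * (Lf ^ 2 * w * ρ * τV ^ 2 / 8) := by gcongr
    linarith
end

section
/- Let γ > 0, a, b ∈ ℝ, T_p > 0, r ≥ 0 and r_V ≥ T_p, and define x : ℝ → ℝ by x(t) = e^{-γ·t}·(a + b·cos(2π·t/T_p)). Then for every t ∈ ℝ: sup_{s ∈ [-(r_V + 2r), 0]} |x(t+s)| ≤ e^{γ·(2r + r_V)} · sup_{s ∈ [-r_V, 0]} |x(t+s)|. (In particular, the ratio bound ‖x_t‖_{r_V + 2r} ≤ w·‖x_t‖_{r_V} holds with w = e^{γ·(2r + r_V)} uniformly in t, because the window of length r_V ≥ T_p contains a full period, so sup_{s ∈ [-r_V,0]} |x(t+s)| ≥ e^{-γ·t}·(|a| + |b|), while sup_{s ∈ [-(r_V+2r),0]} |x(t+s)| ≤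 e^{-γ·(t - r_V - 2r)}·(|a| + |b|).) -/
open Set Real

/-- Every closed window of one period contains a point of any prescribed phase. -/
theorem exists_mem_Icc_cos_eq {Tp : ℝ} (hTp : 0 < Tp) (t φ : ℝ) :
    ∃ s ∈ Icc (-Tp) (0 : ℝ), Real.cos (2 * π * (t + s) / Tp) = Real.cos (2 * π * φ) := by
  have hle := Int.floor_le (t / Tp - φ)
  have hlt := Int.lt_floor_add_one (t / Tp - φ)
  have ht : Tp * (t / Tp) = t := mul_div_cancel₀ t hTp.ne'
  refine ⟨Tp * (⌊t / Tp - φ⌋ + φ) - t, ⟨?_, ?_⟩, ?_⟩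
  · nlinarith
  · nlinarith
  · rw [← Real.cos_add_int_mul_two_pi (2 * π * φ) ⌊t / Tp - φ⌋]
    congr 1
    field_simp
    ring

/-- Every window of one period contains a point where `|a + b·cos|` attains `|a| + |b|`. -/
theorem exists_mem_Icc_abs_add_mul_cos_eq {Tp : ℝ} (hTp : 0 < Tp) (a b t : ℝ) :
    ∃ s ∈ Icc (-Tp) (0 : ℝ), |a + b * Real.cos (2 * π * (t + s) / Tp)| = |a| + |b| := by
  rcases le_total 0 (a * b) with h | h
  · obtain ⟨s, hs, hc⟩ := exists_mem_Icc_cos_eq hTp t 0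
    refine ⟨s, hs, ?_⟩
    rw [hc, mul_zero, Real.cos_zero, mul_one]
    exact (abs_add_eq_add_abs_iff a b).2 (mul_nonneg_iff.1 h)
  · obtain ⟨s, hs, hc⟩ := exists_mem_Icc_cos_eq hTp t (1 / 2)
    refine ⟨s, hs, ?_⟩
    rw [hc, show 2 * π * (1 / 2) = π by ring, Real.cos_pi, mul_neg_one, ← abs_neg b]
    exact (abs_add_eq_add_abs_iff a (-b)).2 (mul_nonneg_iff.1 (by linarith [mul_neg a b]))

theorem abs_add_mul_cos_le (a b θ : ℝ) : |a + b * Real.cos θ| ≤ |a| + |b| := by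
  refine (abs_add_le _ _).trans (add_le_add le_rfl ?_)
  rw [abs_mul]
  exact mul_le_of_le_one_right (abs_nonneg b) (Real.abs_cos_le_one θ)

/-- For exponentially decaying oscillations `x(t) = e^{-γt}(a + b·cos(2πt/T_p))`, the
window-ratio bound `‖x_t‖_{r_V + 2r} ≤ e^{γ(2r + r_V)}·‖x_t‖_{r_V}` holds uniformly in
`t`, provided the window `r_V` covers at least one full period `T_p`. -/
theorem decaying_oscillation_window_ratio
    {γ a b Tp r rV : ℝ} (hγ : 0 < γ) (hTp : 0 < Tp) (hr : 0 ≤ r) (hrV : Tp ≤ rV)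
    (x : ℝ → ℝ)
    (hx : ∀ t : ℝ, x t = Real.exp (-γ * t) * (a + b * Real.cos (2 * π * t / Tp))) :
    ∀ t : ℝ,
      (⨆ s : Icc (-(rV + 2 * r)) (0:ℝ), |x (t + s.1)|) ≤
        Real.exp (γ * (2 * r + rV)) * ⨆ s : Icc (-rV) (0:ℝ), |x (t + s.1)| := by
  intro t
  have habs : ∀ u, |x u| = Real.exp (-γ * u) * |a + b * Real.cos (2 * π * u / Tp)| := fun u => by
    rw [hx, abs_mul, Real.abs_exp]
  have upper : ∀ ρ s, -ρ ≤ s → |x (t + s)| ≤ Real.exp (γ * ρ) * (Real.exp (-γ * t) * (|a| + |b|)) := by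
    intro ρ s hs
    rw [habs, ← mul_assoc, ← Real.exp_add]
    exact mul_le_mul (Real.exp_le_exp.2 (by nlinarith)) (abs_add_mul_cos_le _ _ _)
      (abs_nonneg _) (Real.exp_pos _).le
  have lower : Real.exp (-γ * t) * (|a| + |b|) ≤ ⨆ s : Icc (-rV) (0:ℝ), |x (t + s.1)| := by
    obtain ⟨s, ⟨hs, hs0⟩, hval⟩ := exists_mem_Icc_abs_add_mul_cos_eq hTp a b t
    have hbdd : BddAbove (range fun s : Icc (-rV) (0:ℝ) => |x (t + s.1)|) :=
      ⟨_, forall_mem_range.2 fun s => upper rV s.1 s.2.1⟩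
    refine le_trans ?_ (le_ciSup hbdd ⟨s, by linarith, hs0⟩)
    rw [habs, hval]
    exact mul_le_mul_of_nonneg_right (Real.exp_le_exp.2 (by nlinarith)) (by positivity)
  have : Nonempty (Icc (-(rV + 2 * r)) (0:ℝ)) := ⟨⟨0, by linarith, le_rfl⟩⟩
  refine ciSup_le fun s => (upper (2 * r + rV) s.1 (by linarith [s.2.1])).trans ?_
  exact mul_le_mul_of_nonneg_left lower (Real.exp_pos _).le
end
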